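/- Let H = −2cα r·(1/r), i.e. H = −2cα with α = 1/(√(4c²+1) r) for c, r > 0, W = 0, and set e₁α = −α², e₁H = 2cα², V(H) = 4c²α³, e₁V(H) = −12c²α⁴, e₁e₁H = −4cα³. Then the Euler-Lagrange expression ℰ₂ = (4/9)[H·e₁e₁H + 3e₁V(H) + (e₁H)² + H⁴/3 + 3(e₁α)² + 12α²·e₁α + 12α⁴ − αH·e₁H + 2H²·e₁α + 5α²H²] vanishes for all r > 0 if and only if c² = 3/4. -/

import Mathlib

/-- After substitution the Euler-Lagrange expression is `(4/27) (4c² - 3)² α⁴`. -/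
theorem eulerLagrange_eq (c α : ℝ) :
    (4/9) * ((-2*c*α)*(-4*c*α^3) + 3*(-12*c^2*α^4) + (2*c*α^2)^2 + (-2*c*α)^4/3
        + 3*(-α^2)^2 + 12*α^2*(-α^2) + 12*α^4
        - α*(-2*c*α)*(2*c*α^2) + 2*(-2*c*α)^2*(-α^2) + 5*α^2*(-2*c*α)^2)
      = (4/27) * (4*c^2 - 3)^2 * α^4 := by
  ring

/-- For the surface `t = c r²` in the Heisenberg group (`W = 0`), with
`α = 1/(√(4c²+1) r)`, `H = -2cα`, `e₁α = -α²`, `e₁H = 2cα²`,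
`V(H) = 4c²α³`, `e₁V(H) = -12c²α⁴`, `e₁e₁H = -4cα³`, the Euler-Lagrange
expression `ℰ₂` vanishes for all `r > 0` if and only if `c² = 3/4`. -/
theorem stmt16 (c : ℝ) (hc : 0 < c) :
    (∀ r : ℝ, 0 < r →
      let α := 1/(Real.sqrt (4*c^2 + 1) * r)
      let H := -2*c*α
      (4/9) * (H*(-4*c*α^3) + 3*(-12*c^2*α^4) + (2*c*α^2)^2 + H^4/3
        + 3*(-α^2)^2 + 12*α^2*(-α^2) + 12*α^4
        - α*H*(2*c*α^2) + 2*H^2*(-α^2) + 5*α^2*H^2) = 0)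
    ↔ c^2 = 3/4 := by
  simp only [eulerLagrange_eq]
  constructor
  · intro h
    have hα : (1/(Real.sqrt (4*c^2 + 1) * 1))^4 ≠ 0 := by positivity
    have hsq : (4*c^2 - 3)^2 = 0 := by
      simpa using (mul_eq_zero.mp (h 1 one_pos)).resolve_right hα
    linarith [pow_eq_zero_iff two_ne_zero |>.mp hsq]
  · intro h r _
    rw [h]
    norm_num
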